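/- Let d ≥ 1 and let T be a tableau such that the height of the prime path of row d in T is d (equivalently, the height of the prime path of row d in α_d(T) is d). Then T is a ψ-tableau if and only if α_d(T) is a ψ-tableau. -/

import Mathlib

/-!
Common definitions for formalizing "A recursion on maximal chains in the Tamari lattices"
(L. Nelson).

* Young diagrams are encoded by their row-length functions `lam : ℕ → ℕ` (rows indexed from 1,
  with `lam 0 = 0`).
* Dyck paths are lists of steps (north/east).
* Tableaux are encoded by entry functions `f : ℕ × ℕ → ℕ` (1-indexed boxes; value `0` means
  "no box").  The label of box `(x, y)` is `f (x, y)`.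
-/

noncomputable section

namespace TamariMaxChains

/-- A step of a lattice path: north or east. -/
inductive Step : Type
  | N : Step
  | E : Step
deriving DecidableEq

/-- Number of north steps of a path. -/
def nCount (p : List Step) : ℕ := p.count Step.N

/-- Number of east steps of a path. -/
def eCount (p : List Step) : ℕ := p.count Step.E

/-- `p` is a Dyck path: equally many norths and easts, and every prefix has at least as many
north steps as east steps (the path never goes below the diagonal `y = x`). -/
def IsDyck (p : List Step) : Prop :=
  nCount p = eCount p ∧ ∀ q : List Step, q <+: p → eCount q ≤ nCount q

/-- `q` is a prime Dyck path: it meets the slope-one line joining its endpoints only at its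
endpoints. -/
def IsPrimeDyck (q : List Step) : Prop :=
  q ≠ [] ∧ nCount q = eCount q ∧
    ∀ s : List Step, s <+: q → s ≠ [] → s ≠ q → eCount s < nCount s

/-- Covering relation of the Tamari lattice on Dyck paths:  `TamariCoverD P' P` means `P'`
covers `P`, i.e. `P'` is obtained from `P` by swapping an east step that is followed by a north
step with the prime Dyck subpath following it. -/
def TamariCoverD (P' P : List Step) : Prop :=
  ∃ a q b : List Step, IsPrimeDyck q ∧
    P = a ++ Step.E :: (q ++ b) ∧ P' = a ++ (q ++ Step.E :: b)

/-- `lam` is the row-length function of a Young diagram: rows are indexed from `1`,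
`lam x` is the number of boxes in row `x`, rows weakly decrease, finitely many boxes. -/
def IsDiagram (lam : ℕ → ℕ) : Prop :=
  lam 0 = 0 ∧ (∀ x, 1 ≤ x → lam (x + 1) ≤ lam x) ∧ ∃ N, ∀ x, N ≤ x → lam x = 0

/-- The height (number of north steps) of the prime path of row `d ≥ 1` of the Young diagram
with row lengths `lam`:  the least `t ≥ 1` such that either `t = d` (row `0` being regarded as
an infinite row of boxes) or row `d - t` has length at least `lam d + t`. -/
def primeHeight (lam : ℕ → ℕ) (d : ℕ) : ℕ :=
  sInf {t | 1 ≤ t ∧ (t = d ∨ (t < d ∧ lam d + t ≤ lam (d - t)))}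

/-- The last box of row `d` is a corner box (last box of its row and lowest box of
its column). -/
def IsCorner (lam : ℕ → ℕ) (d : ℕ) : Prop := 1 ≤ d ∧ 1 ≤ lam d ∧ lam (d + 1) < lam d

/-- The result of removing the `B`-strip of the last box `B` of row `d`: the last box of each of
the rows `d - h + 1, …, d` is removed, where `h` is the height of the prime path of row `d`. -/
def removeStrip (lam : ℕ → ℕ) (d : ℕ) : ℕ → ℕ := fun x =>
  if d + 1 ≤ x + primeHeight lam d ∧ x ≤ d then lam x - 1 else lam x

/-- Covering relation of the Tamari lattice on Young diagrams:  `mu` covers `lam` iff `mu` is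
obtained from `lam` by removing the `B`-strip of a corner box `B`. -/
def TamariCoverY (mu lam : ℕ → ℕ) : Prop := ∃ d, IsCorner lam d ∧ mu = removeStrip lam d

/-- The `B`-strip of the last box `B` of row `d`: the set of last boxes of rows
`d - h + 1, …, d`, where `h` is the height of the prime path of row `d`. -/
def stripSet (lam : ℕ → ℕ) (d : ℕ) : Set (ℕ × ℕ) :=
  {b | b.2 = lam b.1 ∧ 1 ≤ b.2 ∧ d + 1 ≤ b.1 + primeHeight lam d ∧ b.1 ≤ d}

/-- The enclosure of the `B`-strip of the last box `B = (d, lam d)` of row `d`: all boxes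
`(x, y)` with `d - h ≤ x ≤ d` and `lam d ≤ y ≤ lam d + h`, where row `0` is regarded as an
infinite row of boxes. -/
def enclosure (lam : ℕ → ℕ) (d : ℕ) : Set (ℕ × ℕ) :=
  {b | (b.1 = 0 ∨ b.2 ≤ lam b.1) ∧ 1 ≤ b.2 ∧
    d ≤ b.1 + primeHeight lam d ∧ b.1 ≤ d ∧ lam d ≤ b.2 ∧ b.2 ≤ lam d + primeHeight lam d}

/-- The Dyck path of length `2 n` corresponding to the Young diagram `lam` contained in the
staircase `δ_{n-1}` (the Dyck path is the silhouette of the Young diagram). -/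
def toDyck (n : ℕ) (lam : ℕ → ℕ) : List Step :=
  ((List.range n).flatMap fun k =>
    List.replicate (lam (n - k) - lam (n - k + 1)) Step.E ++ [Step.N]) ++
    List.replicate (n - lam 1) Step.E

/-- The prime path of row `d` of the Young diagram `lam`, as its list of steps (read from its
lower-left endpoint). -/
def primePathList (lam : ℕ → ℕ) (d : ℕ) : List Step :=
  Step.N :: ((((List.range (primeHeight lam d - 1)).flatMap fun j =>
    List.replicate (lam (d - 1 - j) - lam (d - j)) Step.E ++ [Step.N])) ++
    List.replicate (lam d + primeHeight lam d - lam (d - (primeHeight lam d - 1))) Step.E)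

/-- `S` translates to `S'` by `p` units down and `q` units to the right. -/
def TranslatesBy (p q : ℤ) (S S' : Set (ℕ × ℕ)) : Prop :=
  ∀ x y : ℕ, (x, y) ∈ S' ↔ ∃ a b : ℕ, (a, b) ∈ S ∧ (x : ℤ) = a + p ∧ (y : ℤ) = b + q

/-- `S` translates to `S'`. -/
def Translates (S S' : Set (ℕ × ℕ)) : Prop := ∃ p q : ℤ, TranslatesBy p q S S'

/-- The length of a tableau: its number of distinct labels (for an honest tableau, labels are
exactly `1, …, tlen f`). -/
def tlen (f : ℕ × ℕ → ℕ) : ℕ := sSup {v | v ≠ 0 ∧ ∃ b, f b = v}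

/-- The number of boxes in row `x` of a tableau. -/
def rowLen (f : ℕ × ℕ → ℕ) (x : ℕ) : ℕ := sSup {y | f (x, y) ≠ 0}

/-- The number of boxes in column `y` of a tableau. -/
def colLen (f : ℕ × ℕ → ℕ) (y : ℕ) : ℕ := sSup {x | f (x, y) ≠ 0}

/-- `f` is (the entry function of) a tableau: the support is a Young diagram (1-indexed),
rows strictly increase, columns weakly increase, and the set of labels is exactly
`{1, …, tlen f}`. -/
def IsTableau (f : ℕ × ℕ → ℕ) : Prop :=
  (∀ y, f (0, y) = 0) ∧ (∀ x, f (x, 0) = 0) ∧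
  {b : ℕ × ℕ | f b ≠ 0}.Finite ∧
  (∀ x y x' y', 1 ≤ x' → x' ≤ x → 1 ≤ y' → y' ≤ y → f (x, y) ≠ 0 → f (x', y') ≠ 0) ∧
  (∀ x y, f (x, y) ≠ 0 → f (x, y + 1) ≠ 0 → f (x, y) < f (x, y + 1)) ∧
  (∀ x y, f (x, y) ≠ 0 → f (x + 1, y) ≠ 0 → f (x, y) ≤ f (x + 1, y)) ∧
  (∀ v, 1 ≤ v → (v ≤ tlen f ↔ ∃ b, f b = v))

/-- `T^(r)`: the subtableau of all entries at most `r`. -/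
def trunc (f : ℕ × ℕ → ℕ) (r : ℕ) : ℕ × ℕ → ℕ := fun b => if f b ≤ r then f b else 0

/-- The shape (row-length function) of a tableau. -/
def shapeOf (f : ℕ × ℕ → ℕ) : ℕ → ℕ := fun x => rowLen f x

/-- The row index of the end-box of the `k`-set of `f` (the maximal row index of a box
labeled `k`). -/
def endRow (f : ℕ × ℕ → ℕ) (k : ℕ) : ℕ := sSup {x | ∃ y, f (x, y) = k}

/-- `Y 0 ⋗ Y 1 ⋗ ⋯ ⋗ Y l` is a saturated chain in the Tamari order on Young diagrams whose
maximal element `Y 0` is the empty diagram (each `Y r` covers `Y (r+1)`). -/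
def IsTamariChain (Y : ℕ → ℕ → ℕ) (l : ℕ) : Prop :=
  (∀ r, r ≤ l → IsDiagram (Y r)) ∧ (∀ x, Y 0 x = 0) ∧
    ∀ r, r < l → TamariCoverY (Y r) (Y (r + 1))

/-- The tableau `ψ(C)` of the saturated chain `C = (∅ = Y 0 ⋗ ⋯ ⋗ Y l)`: the boxes removed in
the transition `Y (r-1) ⋗ Y r` are labeled `r`; that is, each box of `Y l` is labeled by the
least `r` such that the box belongs to `Y r`. -/
def psiFun (Y : ℕ → ℕ → ℕ) (l : ℕ) : ℕ × ℕ → ℕ := fun b =>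
  if 1 ≤ b.1 ∧ 1 ≤ b.2 ∧ b.2 ≤ Y l b.1 then sInf {r | r ≤ l ∧ b.2 ≤ Y r b.1} else 0

/-- `f` is a `ψ`-tableau: it is in the image of `ψ`. -/
def IsPsiTab (f : ℕ × ℕ → ℕ) : Prop :=
  ∃ l Y, IsTamariChain Y l ∧ f = psiFun Y l

/-- Row lengths of the staircase shape `δ_{n-1} = (n-1, n-2, …, 1)`: row `x ≥ 1` has `n - x`
boxes. -/
def dstair (n : ℕ) : ℕ → ℕ := fun x => if x = 0 then 0 else n - x

/-- `C_i(n)`, via `ψ`: the set of maximal chains of length `n + i` in the Tamari lattice `T_n`,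
identified with the `ψ`-tableaux of length `n + i` and shape `δ_{n-1}`. -/
def MemC (i : ℤ) (n : ℕ) (f : ℕ × ℕ → ℕ) : Prop :=
  IsTableau f ∧ IsPsiTab f ∧ (∀ x, rowLen f x = dstair n x) ∧ (tlen f : ℤ) = (n : ℤ) + i

/-- The `r`-set of `f` (of shape `δ_{n-1}`) is a full-set with end-box `(k, n - k)`:
it begins in row `1` and ends in the outer diagonal, at the box `(k, n - k)`. -/
def HasFullSetAt (f : ℕ × ℕ → ℕ) (n r k : ℕ) : Prop :=
  (∃ y, f (1, y) = r) ∧ 1 ≤ k ∧ k ≤ n - 1 ∧ f (k, n - k) = r ∧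
    ∀ x y, f (x, y) = r → x ≤ k

/-- `f` has an `r`-full-set. -/
def HasFullSet (f : ℕ × ℕ → ℕ) (n r : ℕ) : Prop := ∃ k, HasFullSetAt f n r k

/-- `f` has an `r⁺`-full-set (plus-full-set): an `r`-full-set whose end-box `(k, n-k)` satisfies
`k = n - 1`, or `k ≤ n - 2` and the southwest neighbor has a smaller label. -/
def HasPlusFullSet (f : ℕ × ℕ → ℕ) (n r : ℕ) : Prop :=
  ∃ k, HasFullSetAt f n r k ∧ (k = n - 1 ∨ (k ≤ n - 2 ∧ f (k + 1, n - k - 1) < r))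

/-- `F_i^r(n)`: the set of `C ∈ C_i(n)` whose `r`-set is a plus-full-set and whose `j`-set is
not a plus-full-set for any `j ∈ [r-1]`. -/
def MemF (i : ℤ) (n : ℕ) (r : ℕ) (f : ℕ × ℕ → ℕ) : Prop :=
  MemC i n f ∧ HasPlusFullSet f n r ∧ ∀ j, 1 ≤ j → j < r → ¬ HasPlusFullSet f n j

/-- `N_i(n)`: the set of `C ∈ C_i(n)` having no plus-full-sets. -/
def MemN (i : ℤ) (n : ℕ) (f : ℕ × ℕ → ℕ) : Prop :=
  MemC i n f ∧ ∀ r, ¬ HasPlusFullSet f n r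

/-- `α_d`: shift all rows of index greater than `d` down one row and repeat row `d` in
row `d + 1`. -/
def alphaFun (d : ℕ) (f : ℕ × ℕ → ℕ) : ℕ × ℕ → ℕ := fun b =>
  if b.1 ≤ d then f b else f (b.1 - 1, b.2)

/-- `β_d`: append a box labeled `tlen f + 1` at the end of each of the rows `1, …, d`. -/
def betaFun (d : ℕ) (f : ℕ × ℕ → ℕ) : ℕ × ℕ → ℕ := fun b =>
  if 1 ≤ b.1 ∧ b.1 ≤ d ∧ b.2 = rowLen f b.1 + 1 then tlen f + 1 else f b

/-- The number of boxes of row `x` of `f` whose label is at most `r` (these occupy an initial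
segment of the row). -/
def lowLen (f : ℕ × ℕ → ℕ) (r x : ℕ) : ℕ := sSup {y | f (x, y) ≠ 0 ∧ f (x, y) ≤ r}

/-- The row index `d` used in the definition of `Ĉ(r)`: the minimal `k ∈ [n-1]` with
`C (k, n-k) ≤ r` if such `k` exists, and `n` otherwise. -/
def hatD (f : ℕ × ℕ → ℕ) (n r : ℕ) : ℕ :=
  sInf ({k | 1 ≤ k ∧ k ≤ n - 1 ∧ 1 ≤ f (k, n - k) ∧ f (k, n - k) ≤ r} ∪ {n})

/-- `Ĉ(r)` for `C ∈ C_i(n)` and `0 ≤ r ≤ n + i`: starting from `β_d(α_d(C^(r)))` (where `d` is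
as in `hatD`), the entries of `C` greater than `r` of row index less than `d` are translated one
unit to the right, those of row index greater than `d` are translated one unit down, and all
these labels are incremented by one. -/
def hatFun (f : ℕ × ℕ → ℕ) (n r : ℕ) : ℕ × ℕ → ℕ := fun b =>
  let d := hatD f n r
  let x := b.1
  let y := b.2
  if x = 0 ∨ y = 0 then 0
  else if x ≤ d then
    if f (x, y) ≠ 0 ∧ f (x, y) ≤ r then f (x, y)
    else if y = lowLen f r x + 1 then r + 1
    else if r < f (x, y - 1) then f (x, y - 1) + 1
    else 0
  else if x = d + 1 then f (d, y)
  else if f (x - 1, y) = 0 then 0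
  else if f (x - 1, y) ≤ r then f (x - 1, y)
  else f (x - 1, y) + 1

/-- `RepBy i m t r C0 C` : `C = (φ_{i,m+t-1}^{r 1} ∘ φ_{i,m+t-2}^{r 2} ∘ ⋯ ∘ φ_{i,m}^{r t}) C0`,
each factor being applied within its domain. -/
def RepBy (i : ℤ) (m t : ℕ) (r : ℕ → ℕ) (C0 C : ℕ × ℕ → ℕ) : Prop :=
  ∃ D : ℕ → ℕ × ℕ → ℕ, D 0 = C0 ∧ D t = C ∧
    ∀ s, s < t →
      MemC i (m + s) (D s) ∧
      ((r (t - s) : ℤ) ≤ (m : ℤ) + s + i) ∧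
      (∀ j, 1 ≤ j → j ≤ r (t - s) → ¬ HasPlusFullSet (D s) (m + s) j) ∧
      D (s + 1) = hatFun (D s) (m + s) (r (t - s))

/-- The set `𝕏_{d,n-1}^r` of Theorem 4.3: `ψ`-tableaux of length `r`, contained in `δ_{n-1}`,
whose row `d` has length `n - d` and whose prime path of row `d` has height `d`. -/
def MemX (d n r : ℕ) (f : ℕ × ℕ → ℕ) : Prop :=
  IsTableau f ∧ IsPsiTab f ∧ tlen f = r ∧
    (∀ x, 1 ≤ x → rowLen f x ≤ n - x) ∧
    rowLen f d = n - d ∧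
    primeHeight (shapeOf f) d = d

/-- The set `ℤ_{d,n}^{r+1}` of Theorem 4.3: `ψ`-tableaux of length `r + 1`, contained in `δ_n`,
such that rows `d` and `d+1` of the truncation at `r` are identical, the end-box of the
`(r+1)`-set is `(d, n-d+1)`, and the prime path of `(d, n-d+1)` has height `d`. -/
def MemZ (d n r : ℕ) (g : ℕ × ℕ → ℕ) : Prop :=
  IsTableau g ∧ IsPsiTab g ∧ tlen g = r + 1 ∧
    (∀ x, 1 ≤ x → rowLen g x ≤ n + 1 - x) ∧
    (∀ y, trunc g r (d, y) = trunc g r (d + 1, y)) ∧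
    g (d, n - d + 1) = r + 1 ∧ (∀ x y, g (x, y) = r + 1 → x ≤ d) ∧
    primeHeight (shapeOf g) d = d

/-! ### Proof material -/

/-- Every earlier row is strictly inside the diagonal through the end of row `d`. -/
def PrimeFull (lam : ℕ → ℕ) (d : ℕ) : Prop := ∀ z, 1 ≤ z → z < d → lam z + z < lam d + d

/-- The shape operation underlying `alphaFun`. -/
def rowDup (d : ℕ) (lam : ℕ → ℕ) : ℕ → ℕ := fun x => if x ≤ d then lam x else lam (x - 1)

/-- The inverse operation: delete row `d + 1`. -/
def rowDel (d : ℕ) (lam : ℕ → ℕ) : ℕ → ℕ := fun x => if x ≤ d then lam x else lam (x + 1)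

theorem strip_iff (lam : ℕ → ℕ) (c x : ℕ) (hc : 1 ≤ c) :
    (c + 1 ≤ x + primeHeight lam c ∧ x ≤ c) ↔
      (1 ≤ x ∧ x ≤ c ∧ ∀ z, x ≤ z → z < c → lam z + z < lam c + c) := by
  have hne : {t | 1 ≤ t ∧ (t = c ∨ (t < c ∧ lam c + t ≤ lam (c - t)))}.Nonempty :=
    ⟨c, hc, Or.inl rfl⟩
  have hmem : primeHeight lam c ∈ {t | 1 ≤ t ∧ (t = c ∨ (t < c ∧ lam c + t ≤ lam (c - t)))} :=
    Nat.sInf_mem hne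
  have hmin : ∀ t, 1 ≤ t → (t = c ∨ (t < c ∧ lam c + t ≤ lam (c - t))) →
      primeHeight lam c ≤ t := fun t h1 h2 => Nat.sInf_le ⟨h1, h2⟩
  have hle : primeHeight lam c ≤ c := hmin c hc (Or.inl rfl)
  constructor
  · rintro ⟨h1, h2⟩
    refine ⟨by omega, h2, fun z hz hzc => ?_⟩
    by_contra hcon
    have := hmin (c - z) (by omega) (by
      rcases Nat.eq_zero_or_pos z with h | h
      · left; omega
      · right
        have : c - (c - z) = z := by omega
        rw [this]; omega)
    omega
  · rintro ⟨h1, h2, h3⟩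
    refine ⟨?_, h2⟩
    obtain ⟨h4, h5⟩ := hmem
    rcases h5 with h5 | ⟨h5, h6⟩
    · omega
    · by_contra hcon
      have := h3 (c - primeHeight lam c) (by omega) (by omega)
      omega

theorem primeFull_iff (lam : ℕ → ℕ) (d : ℕ) (hd : 1 ≤ d) :
    primeHeight lam d = d ↔ PrimeFull lam d := by
  have h := strip_iff lam d 1 hd
  have hle : primeHeight lam d ≤ d := Nat.sInf_le ⟨hd, Or.inl rfl⟩
  constructor
  · intro e
    exact (h.1 ⟨by omega, hd⟩).2.2
  · intro e
    have := (h.2 ⟨le_refl _, hd, e⟩).1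
    omega

theorem removeStrip_pos (lam : ℕ → ℕ) (c x : ℕ) (hc : 1 ≤ c) (h1 : 1 ≤ x) (h2 : x ≤ c)
    (h3 : ∀ z, x ≤ z → z < c → lam z + z < lam c + c) : removeStrip lam c x = lam x - 1 := by
  unfold removeStrip
  rw [if_pos ((strip_iff lam c x hc).2 ⟨h1, h2, h3⟩)]

theorem removeStrip_neg (lam : ℕ → ℕ) (c x : ℕ) (hc : 1 ≤ c)
    (h : ¬ (1 ≤ x ∧ x ≤ c ∧ ∀ z, x ≤ z → z < c → lam z + z < lam c + c)) :
    removeStrip lam c x = lam x := by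
  unfold removeStrip
  rw [if_neg (fun h' => h ((strip_iff lam c x hc).1 h'))]

theorem diagram_anti {lam : ℕ → ℕ} (h : IsDiagram lam) {x y : ℕ} (hx : 1 ≤ x) (hxy : x ≤ y) :
    lam y ≤ lam x := by
  induction y, hxy using Nat.le_induction with
  | base => exact le_rfl
  | succ n hn ih => exact (h.2.1 n (by omega)).trans ih

theorem primeFull_remove {lam : ℕ → ℕ} (hl : IsDiagram lam) {d c : ℕ} (hd : 1 ≤ d)
    (hc : IsCorner lam c) (h : PrimeFull lam d) : PrimeFull (removeStrip lam c) d := by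
  obtain ⟨c1, c2, c3⟩ := hc
  intro z hz hzd
  have hg := h z hz hzd
  by_cases hs : 1 ≤ d ∧ d ≤ c ∧ ∀ w, d ≤ w → w < c → lam w + w < lam c + c
  · obtain ⟨_, hs2, hs3⟩ := hs
    have hdc : lam d + d ≤ lam c + c := by
      rcases hs2.eq_or_lt with e | e
      · rw [e]
      · exact (hs3 d le_rfl e).le
    rw [removeStrip_pos lam c d c1 hd hs2 hs3, removeStrip_pos lam c z c1 hz (by omega) ?_]
    · have := diagram_anti hl hz (show z ≤ c by omega)
      have := diagram_anti hl hd hs2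
      omega
    · intro w hw hwc
      by_cases hwd : d ≤ w
      · exact hs3 w hwd hwc
      · have := h w (by omega) (by omega)
        omega
  · rw [removeStrip_neg lam c d c1 hs]
    have : removeStrip lam c z ≤ lam z := by
      unfold removeStrip; split_ifs <;> omega
    omega

theorem primeFull_chain {Y : ℕ → ℕ → ℕ} {l d : ℕ} (hY : IsTamariChain Y l) (hd : 1 ≤ d)
    (h : PrimeFull (Y l) d) : ∀ r, r ≤ l → PrimeFull (Y r) d := by
  intro r hr
  induction hr using Nat.decreasingInduction with
  | self => exact h
  | of_succ k hk ih =>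
    obtain ⟨c, hc, e⟩ := hY.2.2 k hk
    rw [e]
    exact primeFull_remove (hY.1 _ hk) hd hc ih

theorem rowDup_strip {lam : ℕ → ℕ} {d c : ℕ} (hd : 1 ≤ d) (hc : 1 ≤ c)
    (h : PrimeFull lam d) :
    removeStrip (rowDup d lam) (if c < d then c else c + 1) = rowDup d (removeStrip lam c) := by
  have lo : ∀ x, x ≤ d → rowDup d lam x = lam x := fun x hx => by simp [rowDup, hx]
  have hi : ∀ x, d ≤ x → rowDup d lam (x + 1) = lam x := fun x hx => by
    simp [rowDup, show ¬ (x + 1 ≤ d) by omega]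
  funext x
  by_cases hcd : c < d
  · rw [if_pos hcd]
    by_cases hx : x ≤ d
    · have hR : rowDup d (removeStrip lam c) x = removeStrip lam c x := by simp [rowDup, hx]
      rw [hR]
      by_cases hs : 1 ≤ x ∧ x ≤ c ∧ ∀ w, x ≤ w → w < c → lam w + w < lam c + c
      · obtain ⟨s1, s2, s3⟩ := hs
        rw [removeStrip_pos lam c x hc s1 s2 s3, removeStrip_pos _ c x hc s1 s2 ?_, lo x hx]
        intro w hw hwc
        rw [lo w (by omega), lo c (by omega)]
        exact s3 w hw hwc
      · rw [removeStrip_neg lam c x hc hs, removeStrip_neg _ c x hc ?_, lo x hx]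
        rintro ⟨s1, s2, s3⟩
        refine hs ⟨s1, s2, fun w hw hwc => ?_⟩
        have := s3 w hw hwc
        rwa [lo w (by omega), lo c (by omega)] at this
    · have hR : rowDup d (removeStrip lam c) x = removeStrip lam c (x - 1) := by
        simp [rowDup, hx]
      rw [hR, removeStrip_neg lam c _ hc (by omega), removeStrip_neg _ c x hc (by omega)]
      simp [rowDup, hx]
  · rw [if_neg hcd]
    have hdc : d ≤ c := by omega
    by_cases hx : x ≤ d
    · have hR : rowDup d (removeStrip lam c) x = removeStrip lam c x := by simp [rowDup, hx]
      rw [hR]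
      by_cases hs : 1 ≤ x ∧ x ≤ c ∧ ∀ w, x ≤ w → w < c → lam w + w < lam c + c
      · obtain ⟨s1, s2, s3⟩ := hs
        rw [removeStrip_pos lam c x hc s1 s2 s3,
          removeStrip_pos _ (c + 1) x (by omega) s1 (by omega) ?_, lo x hx]
        intro w hw hwc
        rw [hi c hdc]
        by_cases hwd : w ≤ d
        · rw [lo w hwd]
          rcases Nat.lt_or_ge w c with e | e
          · have := s3 w hw e
            omega
          · have : w = c := by omega
            rw [this]; omega
        · obtain ⟨v, rfl⟩ : ∃ v, w = v + 1 := ⟨w - 1, by omega⟩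
          rw [hi v (by omega)]
          have := s3 v (by omega) (by omega)
          omega
      · rw [removeStrip_neg lam c x hc hs, removeStrip_neg _ (c + 1) x (by omega) ?_, lo x hx]
        rintro ⟨s1, s2, s3⟩
        have key : ∀ v, d ≤ v → v < c → lam v + v < lam c + c := by
          intro v hv hvc
          have := s3 (v + 1) (by omega) (by omega)
          rw [hi v hv, hi c hdc] at this
          omega
        refine hs ⟨s1, by omega, fun w hw hwc => ?_⟩
        by_cases hwd : d ≤ w
        · exact key w hwd hwc
        · have h1 := h w (by omega) (by omega)
          rcases hdc.eq_or_lt with e | e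
          · rw [← e]; exact h1
          · have := key d le_rfl e
            omega
    · obtain ⟨v, rfl⟩ : ∃ v, x = v + 1 := ⟨x - 1, by omega⟩
      have hR : rowDup d (removeStrip lam c) (v + 1) = removeStrip lam c v := by
        simp [rowDup, hx]
      rw [hR]
      by_cases hs : 1 ≤ v ∧ v ≤ c ∧ ∀ w, v ≤ w → w < c → lam w + w < lam c + c
      · obtain ⟨s1, s2, s3⟩ := hs
        rw [removeStrip_pos lam c v hc s1 s2 s3,
          removeStrip_pos _ (c + 1) (v + 1) (by omega) (by omega) (by omega) ?_,
          hi v (by omega)]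
        intro w hw hwc
        obtain ⟨u, rfl⟩ : ∃ u, w = u + 1 := ⟨w - 1, by omega⟩
        rw [hi c hdc, hi u (by omega)]
        have := s3 u (by omega) (by omega)
        omega
      · rw [removeStrip_neg lam c v hc hs, removeStrip_neg _ (c + 1) (v + 1) (by omega) ?_,
          hi v (by omega)]
        rintro ⟨s1, s2, s3⟩
        refine hs ⟨by omega, by omega, fun w hw hwc => ?_⟩
        have := s3 (w + 1) (by omega) (by omega)
        rw [hi c hdc, hi w (by omega)] at this
        omega

theorem rowDup_corner {lam : ℕ → ℕ} {d c : ℕ} (hc : IsCorner lam c) :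
    IsCorner (rowDup d lam) (if c < d then c else c + 1) := by
  obtain ⟨h1, h2, h3⟩ := hc
  by_cases hcd : c < d
  · rw [if_pos hcd]
    refine ⟨h1, ?_, ?_⟩
    · simpa [rowDup, hcd.le] using h2
    · simpa [rowDup, hcd.le, show c + 1 ≤ d from hcd] using h3
  · rw [if_neg hcd]
    refine ⟨by omega, ?_, ?_⟩
    · simpa [rowDup, show ¬ (c + 1 ≤ d) by omega] using h2
    · simpa [rowDup, show ¬ (c + 1 ≤ d) by omega, show ¬ (c + 1 + 1 ≤ d) by omega] using h3

theorem rowDup_corner_inv {lam : ℕ → ℕ} {d c : ℕ} (hd : 1 ≤ d)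
    (hc : IsCorner (rowDup d lam) c) :
    ∃ k, IsCorner lam k ∧ c = if k < d then k else k + 1 := by
  obtain ⟨h1, h2, h3⟩ := hc
  rcases lt_trichotomy c d with hcd | hcd | hcd
  · refine ⟨c, ⟨h1, ?_, ?_⟩, by rw [if_pos hcd]⟩
    · simpa [rowDup, hcd.le] using h2
    · simpa [rowDup, hcd.le, show c + 1 ≤ d from hcd] using h3
  · subst hcd
    simp [rowDup] at h3
  · obtain ⟨k, rfl⟩ : ∃ k, c = k + 1 := ⟨c - 1, by omega⟩
    refine ⟨k, ⟨by omega, ?_, ?_⟩, by rw [if_neg (by omega)]⟩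
    · simpa [rowDup, show ¬ (k + 1 ≤ d) by omega] using h2
    · simpa [rowDup, show ¬ (k + 1 ≤ d) by omega, show ¬ (k + 1 + 1 ≤ d) by omega] using h3

theorem rowDup_diagram {lam : ℕ → ℕ} {d : ℕ} (hd : 1 ≤ d) (h : IsDiagram lam) :
    IsDiagram (rowDup d lam) := by
  obtain ⟨h1, h2, N, h3⟩ := h
  refine ⟨by simp [rowDup, h1], fun x hx => ?_, N + 1, fun x hx => ?_⟩
  · unfold rowDup
    split_ifs with a b b
    · exact h2 x hx
    · omega
    · simp
    · have := h2 (x - 1) (by omega)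
      rwa [show x - 1 + 1 = x by omega] at this
  · unfold rowDup
    split_ifs
    · exact h3 x (by omega)
    · exact h3 _ (by omega)

theorem rowDel_diagram {lam : ℕ → ℕ} {d : ℕ} (h : IsDiagram lam) :
    IsDiagram (rowDel d lam) := by
  have ha := h
  obtain ⟨h1, h2, N, h3⟩ := h
  refine ⟨by simp [rowDel, h1], fun x hx => ?_, N, fun x hx => ?_⟩
  · unfold rowDel
    split_ifs with a b b
    · exact h2 x hx
    · omega
    · exact diagram_anti ha hx (by omega)
    · exact h2 _ (by omega)
  · unfold rowDel
    split_ifs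
    · exact h3 x (by omega)
    · exact h3 _ (by omega)

theorem rowDup_rowDel {lam : ℕ → ℕ} {d : ℕ} (h : lam d = lam (d + 1)) :
    rowDup d (rowDel d lam) = lam := by
  funext x
  unfold rowDup rowDel
  split_ifs with a b
  · rfl
  · have : x = d + 1 := by omega
    subst this
    simpa using h
  · rw [show x - 1 + 1 = x by omega]

theorem rowDup_inj {a b : ℕ → ℕ} {d : ℕ} (h : rowDup d a = rowDup d b) : a = b := by
  funext x
  by_cases hx : x ≤ d
  · simpa [rowDup, hx] using congrFun h x
  · simpa [rowDup, show ¬ (x + 1 ≤ d) by omega] using congrFun h (x + 1)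

theorem alphaFun_inj {a b : ℕ × ℕ → ℕ} {d : ℕ} (h : alphaFun d a = alphaFun d b) : a = b := by
  funext ⟨x, y⟩
  by_cases hx : x ≤ d
  · simpa [alphaFun, hx] using congrFun h (x, y)
  · simpa [alphaFun, show ¬ (x + 1 ≤ d) by omega] using congrFun h (x + 1, y)

theorem psiFun_rowDup (Y : ℕ → ℕ → ℕ) (l d : ℕ) (hd : 1 ≤ d) :
    psiFun (fun r => rowDup d (Y r)) l = alphaFun d (psiFun Y l) := by
  funext ⟨x, y⟩
  by_cases hx : x ≤ d
  · simp [psiFun, alphaFun, rowDup, hx]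
  · simp [psiFun, alphaFun, rowDup, hx, show 1 ≤ x by omega, show 1 ≤ x - 1 by omega]

theorem chain_mono {Y : ℕ → ℕ → ℕ} {l : ℕ} (hY : IsTamariChain Y l) {r s : ℕ} (x : ℕ)
    (hrs : r ≤ s) (hs : s ≤ l) : Y r x ≤ Y s x := by
  induction s, hrs using Nat.le_induction with
  | base => exact le_rfl
  | succ n hn ih =>
    obtain ⟨c, hc, e⟩ := hY.2.2 n (by omega)
    refine (ih (by omega)).trans ?_
    rw [e]
    unfold removeStrip
    split_ifs <;> omega

theorem le_chain_iff {Y : ℕ → ℕ → ℕ} {l : ℕ} (hY : IsTamariChain Y l) {r x y : ℕ}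
    (hr : r ≤ l) (hx : 1 ≤ x) (hy : 1 ≤ y) :
    y ≤ Y r x ↔ psiFun Y l (x, y) ≠ 0 ∧ psiFun Y l (x, y) ≤ r := by
  by_cases hl : y ≤ Y l x
  · have hp : psiFun Y l (x, y) = sInf {r | r ≤ l ∧ y ≤ Y r x} := by
      simp [psiFun, hx, hy, hl]
    have hm : sInf {r | r ≤ l ∧ y ≤ Y r x} ∈ {r | r ≤ l ∧ y ≤ Y r x} :=
      Nat.sInf_mem ⟨l, le_rfl, hl⟩
    rw [hp]
    obtain ⟨m1, m2⟩ := hm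
    constructor
    · intro h
      refine ⟨fun h0 => ?_, Nat.sInf_le ⟨hr, h⟩⟩
      rw [h0, hY.2.1 x] at m2
      omega
    · rintro ⟨_, h⟩
      exact m2.trans (chain_mono hY x h hr)
  · have hp : psiFun Y l (x, y) = 0 := by simp [psiFun, hl]
    have := chain_mono hY x hr le_rfl
    simp only [hp, ne_eq, not_true_eq_false, false_and, iff_false]
    omega

theorem rowLen_psi {Y : ℕ → ℕ → ℕ} {l : ℕ} (hY : IsTamariChain Y l) {x : ℕ} (hx : 1 ≤ x) :
    rowLen (psiFun Y l) x = Y l x := by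
  have hset : ∀ y, psiFun Y l (x, y) ≠ 0 ↔ 1 ≤ y ∧ y ≤ Y l x := by
    intro y
    constructor
    · intro h
      by_contra hc
      apply h
      unfold psiFun
      exact if_neg (fun h' => hc h'.2)
    · rintro ⟨h1, h2⟩
      exact ((le_chain_iff hY le_rfl hx h1).1 h2).1
  unfold rowLen
  simp only [hset]
  rcases Nat.eq_zero_or_pos (Y l x) with h | h
  · have : {y | 1 ≤ y ∧ y ≤ Y l x} = ∅ := by
      ext y; simp; omega
    rw [this, h]; simp
  · exact IsGreatest.csSup_eq ⟨⟨h, le_rfl⟩, fun y hy => hy.2⟩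

theorem primeFull_of_psi {Y : ℕ → ℕ → ℕ} {l d : ℕ} (hd : 1 ≤ d) (hY : IsTamariChain Y l)
    (h : PrimeFull (shapeOf (psiFun Y l)) d) : PrimeFull (Y l) d := by
  intro z hz hzd
  have := h z hz hzd
  simpa [shapeOf, rowLen_psi hY hz, rowLen_psi hY hd] using this

theorem chain_rows_eq {Z : ℕ → ℕ → ℕ} {l d : ℕ} (hd : 1 ≤ d) (hZ : IsTamariChain Z l)
    (h : ∀ y, psiFun Z l (d, y) = psiFun Z l (d + 1, y)) {r : ℕ} (hr : r ≤ l) :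
    Z r d = Z r (d + 1) := by
  have key : ∀ y, 1 ≤ y → (y ≤ Z r d ↔ y ≤ Z r (d + 1)) := fun y hy => by
    rw [le_chain_iff hZ hr hd hy, le_chain_iff hZ hr (by omega) hy, h y]
  apply le_antisymm
  · rcases Nat.eq_zero_or_pos (Z r d) with e | e
    · omega
    · exact (key _ e).1 le_rfl
  · rcases Nat.eq_zero_or_pos (Z r (d + 1)) with e | e
    · omega
    · exact (key _ e).2 le_rfl

/-- **Theorem 3.9(5).**  Let `d ≥ 1` and let `T` be a tableau such that the prime path of row
`d` in `T` has height `d`.  Then `T` is a `ψ`-tableau if and only if `α_d(T)` is a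
`ψ`-tableau. -/
theorem alpha_preserves_psi (d : ℕ) (hd : 1 ≤ d) (f : ℕ × ℕ → ℕ) (hf : IsTableau f)
    (hh : primeHeight (shapeOf f) d = d) :
    IsPsiTab f ↔ IsPsiTab (alphaFun d f) := by
  rw [primeFull_iff _ _ hd] at hh
  constructor
  · rintro ⟨l, Y, hY, rfl⟩
    have hP := primeFull_chain hY hd (primeFull_of_psi hd hY hh)
    refine ⟨l, fun r => rowDup d (Y r), ⟨fun r hr => rowDup_diagram hd (hY.1 r hr), ?_, ?_⟩,
      (psiFun_rowDup Y l d hd).symm⟩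
    · intro x
      simp [rowDup, hY.2.1]
    · intro r hr
      obtain ⟨c, hc, e⟩ := hY.2.2 r hr
      refine ⟨_, rowDup_corner hc, ?_⟩
      rw [rowDup_strip hd hc.1 (hP _ hr)]
      exact congrArg (rowDup d) e
  · rintro ⟨l, Z, hZ, hfZ⟩
    have hrow : ∀ y, psiFun Z l (d, y) = psiFun Z l (d + 1, y) := by
      intro y
      rw [← hfZ]
      simp [alphaFun]
    have hPl : PrimeFull (Z l) d := by
      apply primeFull_of_psi hd hZ
      rw [← hfZ]
      intro z hz hzd
      have := hh z hz hzd
      simpa [shapeOf, rowLen, alphaFun, hzd.le] using this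
    have hP := primeFull_chain hZ hd hPl
    have hdup : ∀ r, r ≤ l → rowDup d (rowDel d (Z r)) = Z r :=
      fun r hr => rowDup_rowDel (chain_rows_eq hd hZ hrow hr)
    have hPY : ∀ r, r ≤ l → PrimeFull (rowDel d (Z r)) d := by
      intro r hr z hz hzd
      have := hP r hr z hz hzd
      simpa [rowDel, hzd.le] using this
    refine ⟨l, fun r => rowDel d (Z r), ⟨fun r hr => rowDel_diagram (hZ.1 r hr), ?_, ?_⟩, ?_⟩
    · intro x
      simp [rowDel, hZ.2.1]
    · intro r hr
      obtain ⟨c, hc, e⟩ := hZ.2.2 r hr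
      rw [← hdup (r + 1) hr] at hc
      obtain ⟨k, hk, rfl⟩ := rowDup_corner_inv hd hc
      refine ⟨k, hk, rowDup_inj (d := d) ?_⟩
      rw [← rowDup_strip hd hk.1 (hPY _ hr), hdup (r + 1) hr, hdup r hr.le, e]
    · apply alphaFun_inj (d := d)
      rw [← psiFun_rowDup _ _ _ hd, hfZ]
      funext ⟨x, y⟩
      have hs : {r | r ≤ l ∧ y ≤ Z r x} = {r | r ≤ l ∧ y ≤ rowDup d (rowDel d (Z r)) x} := by
        ext r
        constructor
        · rintro ⟨h1, h2⟩
          exact ⟨h1, by rw [hdup r h1]; exact h2⟩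
        · rintro ⟨h1, h2⟩
          exact ⟨h1, by rw [hdup r h1] at h2; exact h2⟩
      simp only [psiFun, hs, hdup l le_rfl]

end TamariMaxChains
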